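/- arXiv:2004.06360 — 7 statements merged into one kernel-verified Lean document; each statement's English description precedes it below -/
import Mathlib

section
/- Let K be an n×n real matrix in Jordan form, K = diag(C(λ₁), C(λ₂), …, C(λ_k)), where for each i the block C(λᵢ) is itself a block-diagonal matrix of Jordan blocks all having the same eigenvalue λᵢ on the diagonal and 1 on the superdiagonal, and where λ₁, …, λ_k are pairwise distinct. If S is an n×n real symmetric matrix such that SK is symmetric, then S is block diagonal, S = diag(S₁, S₂, …, S_k), with the size of each block Sᵢ equal to the size of C(λᵢ). -/
open Matrix

/-- The Jordan block of size `d` with eigenvalue `lam`: `lam` on the diagonal,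
`1` on the superdiagonal, `0` elsewhere. -/
def jordanBlock (lam : ℝ) (d : ℕ) : Matrix (Fin d) (Fin d) ℝ :=
  Matrix.of fun a b : Fin d =>
    if (b : ℕ) = (a : ℕ) then lam else if (b : ℕ) = (a : ℕ) + 1 then 1 else 0

/-- Right multiplication by a block diagonal matrix acts on each block of columns separately. -/
theorem mul_blockDiagonal'_apply {l ι : Type*} {m : ι → Type*} [Fintype ι] [DecidableEq ι]
    [∀ i, Fintype (m i)] (T : Matrix l (Σ i, m i) ℝ) (M : ∀ i, Matrix (m i) (m i) ℝ)
    (p : l) (i : ι) (b : m i) :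
    (T * Matrix.blockDiagonal' M) p ⟨i, b⟩ = ∑ c, T p ⟨i, c⟩ * M i c b := by
  rw [Matrix.mul_apply, Fintype.sum_sigma, Finset.sum_eq_single i]
  · simp [Matrix.blockDiagonal'_apply_eq]
  · intro i' _ hi
    refine Finset.sum_eq_zero fun c _ => ?_
    rw [Matrix.blockDiagonal'_apply_ne _ _ _ hi, mul_zero]
  · simp

/-- A row vector vanishing before position `b` is scaled at `b` by the eigenvalue. -/
theorem sum_mul_jordanBlock (x : ℝ) {d : ℕ} (f : Fin d → ℝ) (b : Fin d)
    (hf : ∀ c < b, f c = 0) : ∑ c, f c * jordanBlock x d c b = f b * x := by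
  rw [Finset.sum_eq_single b]
  · simp [jordanBlock]
  · intro c _ hc
    by_cases h : (b : ℕ) = c + 1
    · rw [hf c (Fin.lt_def.2 (by omega)), zero_mul]
    · have hbc : (b : ℕ) ≠ c := fun h' => hc (Fin.ext h'.symm)
      simp [jordanBlock, h, hbc]
  · simp

/-- If `T` and `T * K` are symmetric, with `K` a Jordan matrix, then the entries of `T` between
blocks with different eigenvalues vanish. -/
theorem apply_eq_zero_of_isSymm_mul_jordan {k : ℕ} (lam : Fin k → ℝ) (t : Fin k → ℕ)
    (d : ∀ i : Fin k, Fin (t i) → ℕ)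
    (T : Matrix (Σ i : Fin k, Σ j : Fin (t i), Fin (d i j))
      (Σ i : Fin k, Σ j : Fin (t i), Fin (d i j)) ℝ)
    (hT : T.IsSymm)
    (hTK : (T * Matrix.blockDiagonal' fun i : Fin k =>
      Matrix.blockDiagonal' fun j : Fin (t i) => jordanBlock (lam i) (d i j)).IsSymm)
    {i i' : Fin k} (hi : lam i ≠ lam i') (j : Fin (t i)) (j' : Fin (t i'))
    (a : Fin (d i j)) (b : Fin (d i' j')) : T ⟨i, j, a⟩ ⟨i', j', b⟩ = 0 := by
  have mul_apply_of_forall_lt : ∀ p (i : Fin k) (j : Fin (t i)) (b : Fin (d i j)),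
      (∀ c < b, T p ⟨i, j, c⟩ = 0) →
      (T * Matrix.blockDiagonal' fun i : Fin k =>
        Matrix.blockDiagonal' fun j : Fin (t i) => jordanBlock (lam i) (d i j)) p ⟨i, j, b⟩ =
        T p ⟨i, j, b⟩ * lam i := by
    intro p i j b h
    rw [mul_blockDiagonal'_apply, ← sum_mul_jordanBlock (lam i) (fun c => T p ⟨i, j, c⟩) b h]
    exact mul_blockDiagonal'_apply (Matrix.of fun (_ : Unit) c => T p ⟨i, c⟩) _ () j b
  induction hN : (a : ℕ) + b using Nat.strong_induction_on generalizing a b with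
  | _ N ih =>
    have hcol := mul_apply_of_forall_lt ⟨i, j, a⟩ i' j' b fun c hc =>
      ih _ (by rw [Fin.lt_def] at hc; omega) a c rfl
    have hrow := mul_apply_of_forall_lt ⟨i', j', b⟩ i j a fun c hc => by
      rw [hT.apply]
      exact ih _ (by rw [Fin.lt_def] at hc; omega) c b rfl
    rw [hTK.apply, hcol, hT.apply ⟨i, j, a⟩] at hrow
    have hmul : T ⟨i, j, a⟩ ⟨i', j', b⟩ * (lam i - lam i') = 0 := by linarith
    exact (mul_eq_zero.1 hmul).resolve_right (sub_ne_zero.2 hi)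

/-- Let `K = diag(C(λ₁), …, C(λ_k))` be an `n × n` real Jordan matrix, where
`C(λ i) = diag(K_{i 1}(λ i), …, K_{i tᵢ}(λ i))` is a block diagonal matrix of Jordan blocks
(of sizes `d i j`) all with the same eigenvalue `λ i`, and `λ₁, …, λ_k` are pairwise
distinct.  The identification of the block index set with `Fin n` is recorded by the
equivalences `e` (the fine partition) and `e'` (the coarse partition into the groups
`C(λ i)`), which are compatible via `hee'`.  If `S` is an `n × n` real symmetric matrix
such that `S * K` is symmetric, then `S` is block diagonal, `S = diag(S₁, …, S_k)`, with
each block `Sᵢ` of the same size as `C(λ i)`. -/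
theorem stmt_0 {n k : ℕ} (lam : Fin k → ℝ) (hlam : Function.Injective lam)
    (t : Fin k → ℕ) (d : ∀ i : Fin k, Fin (t i) → ℕ)
    (e : (Σ i : Fin k, Σ j : Fin (t i), Fin (d i j)) ≃ Fin n)
    (e' : (Σ i : Fin k, Fin (∑ j, d i j)) ≃ Fin n)
    (einner : ∀ i : Fin k, (Σ j : Fin (t i), Fin (d i j)) ≃ Fin (∑ j, d i j))
    (hee' : e = (Equiv.sigmaCongrRight einner).trans e')
    (K S : Matrix (Fin n) (Fin n) ℝ)
    (hK : K = Matrix.reindex e e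
      (Matrix.blockDiagonal' fun i : Fin k =>
        Matrix.blockDiagonal' fun j : Fin (t i) => jordanBlock (lam i) (d i j)))
    (hS : S.IsSymm) (hSK : (S * K).IsSymm) :
    ∃ Sb : ∀ i : Fin k, Matrix (Fin (∑ j, d i j)) (Fin (∑ j, d i j)) ℝ,
      S = Matrix.reindex e' e' (Matrix.blockDiagonal' Sb) := by
  have hT : (S.submatrix e e).IsSymm := hS.submatrix e
  have hTK : (S.submatrix e e * Matrix.blockDiagonal' fun i : Fin k =>
      Matrix.blockDiagonal' fun j : Fin (t i) => jordanBlock (lam i) (d i j)).IsSymm := by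
    have h := hSK.submatrix e
    rw [← Matrix.submatrix_mul_equiv S K e e e, hK] at h
    simpa using h
  refine ⟨Matrix.blockDiag' (S.submatrix e' e'), ?_⟩
  rw [← Equiv.symm_apply_eq, Matrix.reindex_symm]
  ext ⟨i, x⟩ ⟨i', y⟩
  by_cases hi : i = i'
  · subst hi
    simp [Matrix.blockDiagonal'_apply_eq, Matrix.blockDiag'_apply]
  · rw [Matrix.blockDiagonal'_apply_ne _ _ _ hi]
    obtain ⟨⟨j, a⟩, rfl⟩ := (einner i).surjective x
    obtain ⟨⟨j', b⟩, rfl⟩ := (einner i').surjective y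
    have h := apply_eq_zero_of_isSymm_mul_jordan lam t d _ hT hTK (hlam.ne hi) j j' a b
    simpa [hee'] using h
end

section
/- Let C¹, C², …, C^m be n×n real symmetric matrices with C¹ nonsingular. Suppose there is an index k with 2 ≤ k ≤ m such that (C¹)⁻¹C^k is real similarly diagonalizable and such that Cⁱ(C¹)⁻¹C^k is symmetric for every i ∈ {2,…,m} with i ≠ k. Then there exists a nonsingular real matrix Q such that QᵀC¹Q = diag(A₁, …, A_r), QᵀC^kQ = diag(β₁A₁, …, β_rA_r), and QᵀCⁱQ = diag(Cⁱ₁, …, Cⁱ_r) for every i ∈ {2,…,m}, i ≠ k, where for each t the blocks A_t and Cⁱ_t are symmetric of the same size m_t × m_t with m₁ + … + m_r = n, each A_t is nonsingular, and β₁, …, β_r are the r distinct eigenvalues of (C¹)⁻¹C^k. -/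
open Matrix

/-- A real square matrix is real similarly diagonalizable if there exists a nonsingular
real matrix `Q` such that `Q⁻¹ A Q` is diagonal. -/
def SimilarlyDiagonalizable {n : ℕ} (A : Matrix (Fin n) (Fin n) ℝ) : Prop :=
  ∃ Q : Matrix (Fin n) (Fin n) ℝ, IsUnit Q ∧ (Q⁻¹ * A * Q).IsDiag

/-- Symmetry is preserved by congruence. -/
theorem isSymm_transpose_mul_mul_self {ι R : Type*} [Fintype ι] [CommRing R]
    (Q : Matrix ι ι R) {S : Matrix ι ι R} (hS : S.IsSymm) : (Qᵀ * S * Q).IsSymm := by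
  rw [IsSymm, transpose_mul, transpose_mul, transpose_transpose, hS, Matrix.mul_assoc]

/-- If `S` and `S * M` are symmetric and `Q` diagonalizes `M`, then the congruence `Qᵀ * S * Q`
couples only indices carrying the same eigenvalue of `M`. -/
theorem transpose_mul_mul_apply_eq_zero {ι : Type*} [Fintype ι] [DecidableEq ι]
    {S M Q : Matrix ι ι ℝ} {d : ι → ℝ} (hS : S.IsSymm) (hSM : (S * M).IsSymm)
    (hMQ : M * Q = Q * diagonal d) {i j : ι} (hij : d i ≠ d j) : (Qᵀ * S * Q) i j = 0 := by
  have hT : (Qᵀ * S * Q).IsSymm := isSymm_transpose_mul_mul_self Q hS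
  have hTD : Qᵀ * S * Q * diagonal d = Qᵀ * (S * M) * Q := by
    simp only [Matrix.mul_assoc, hMQ]
  have hTDs : (Qᵀ * S * Q * diagonal d).IsSymm := by
    rw [hTD]
    exact isSymm_transpose_mul_mul_self Q hSM
  have h := hTDs.apply i j
  rw [mul_diagonal, mul_diagonal, hT.apply i j] at h
  have : (Qᵀ * S * Q) i j * (d i - d j) = 0 := by linear_combination h
  exact (mul_eq_zero.mp this).resolve_right (sub_ne_zero.mpr hij)

/-- A matrix that vanishes between different fibres of `f` is block diagonal along any
enumeration of the index set adapted to `f`. -/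
theorem eq_reindex_blockDiagonal' {ι o R : Type*} {κ : o → Type*} [DecidableEq o] [Zero R]
    {f : ι → o} (e : (Σ t, κ t) ≃ ι) (he : ∀ x, f (e x) = x.1) {T : Matrix ι ι R}
    (hT : ∀ i j, f i ≠ f j → T i j = 0) :
    T = reindex e e (blockDiagonal' fun t => T.submatrix (fun x => e ⟨t, x⟩) fun x => e ⟨t, x⟩) := by
  rw [← (reindex e e).symm_apply_eq]
  ext ⟨s, x⟩ ⟨t, y⟩
  by_cases hst : s = t
  · subst hst
    simp
  · rw [blockDiagonal'_apply_ne _ _ _ hst]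
    exact hT _ _ (by rwa [he, he])

/-- The diagonal blocks of a nonsingular block diagonal matrix are nonsingular. -/
theorem isUnit_of_isUnit_blockDiagonal' {o R : Type*} {κ : o → Type*} [Fintype o] [DecidableEq o]
    [∀ t, Fintype (κ t)] [∀ t, DecidableEq (κ t)] [CommRing R] {A : ∀ t, Matrix (κ t) (κ t) R}
    (hA : IsUnit (blockDiagonal' A)) (t : o) : IsUnit (A t) := by
  obtain ⟨X, hX⟩ := hA.exists_right_inv
  refine IsUnit.of_mul_eq_one (blockDiag' X t) ?_
  ext x y
  have h := congrFun (congrFun hX ⟨t, x⟩) ⟨t, y⟩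
  rw [mul_apply, Fintype.sum_sigma, Finset.sum_eq_single t] at h
  · simpa [mul_apply, blockDiag'_apply, one_apply] using h
  · intro s _ hst
    exact Finset.sum_eq_zero fun z _ => by rw [blockDiagonal'_apply_ne _ _ _ hst.symm, zero_mul]
  · simp

/-- Every real function on a finite type factors as a surjection onto some `Fin r` followed by
an injection. -/
theorem exists_surjective_fin_injective {ι : Type*} [Fintype ι] (d : ι → ℝ) :
    ∃ (r : ℕ) (f : ι → Fin r) (β : Fin r → ℝ),
      Function.Surjective f ∧ Function.Injective β ∧ ∀ i, β (f i) = d i := by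
  let g := Finite.equivFin (Set.range d)
  refine ⟨_, fun i => g (Set.rangeFactorization d i), fun t => g.symm t,
    g.surjective.comp Set.rangeFactorization_surjective,
    Subtype.val_injective.comp g.symm.injective, fun i => ?_⟩
  exact congrArg Subtype.val (g.symm_apply_apply (Set.rangeFactorization d i))

/-- Let `C¹, …, C^m` be `n × n` real symmetric matrices with `C¹` nonsingular
(the collection is indexed by `i ∈ {1, …, m}`).  Suppose there is `k` with `2 ≤ k ≤ m`
such that `(C¹)⁻¹ C^k` is real similarly diagonalizable and `Cⁱ (C¹)⁻¹ C^k` is symmetric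
for every `i ∈ {2, …, m}`, `i ≠ k`.  Then there is a nonsingular real matrix `Q` such that
`Qᵀ C¹ Q = diag(A₁, …, A_r)`, `Qᵀ C^k Q = diag(β₁ A₁, …, β_r A_r)` and
`Qᵀ Cⁱ Q = diag(Cⁱ₁, …, Cⁱ_r)` for `i ∈ {2, …, m}`, `i ≠ k`, where the blocks `A_t`,
`Cⁱ_t` are symmetric of the same size `m_t × m_t`, `m₁ + … + m_r = n`, each `A_t` is
nonsingular, and `β₁, …, β_r` are the `r` distinct eigenvalues of `(C¹)⁻¹ C^k`
(the identification of the block index set with `Fin n` is recorded by an equivalence `e`). -/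
theorem stmt_1 {n m : ℕ} (hm : 2 ≤ m) (C : ℕ → Matrix (Fin n) (Fin n) ℝ)
    (hsymm : ∀ i, 1 ≤ i → i ≤ m → (C i).IsSymm)
    (h1 : IsUnit (C 1))
    (k : ℕ) (hk2 : 2 ≤ k) (hkm : k ≤ m)
    (hdiag : SimilarlyDiagonalizable ((C 1)⁻¹ * C k))
    (hsym2 : ∀ i, 2 ≤ i → i ≤ m → i ≠ k → (C i * ((C 1)⁻¹ * C k)).IsSymm) :
    ∃ (r : ℕ) (msz : Fin r → ℕ) (_ : ∑ t, msz t = n)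
      (e : (Σ t : Fin r, Fin (msz t)) ≃ Fin n)
      (Q : Matrix (Fin n) (Fin n) ℝ) (_ : IsUnit Q)
      (A : ∀ t : Fin r, Matrix (Fin (msz t)) (Fin (msz t)) ℝ)
      (β : Fin r → ℝ)
      (B : ℕ → ∀ t : Fin r, Matrix (Fin (msz t)) (Fin (msz t)) ℝ),
      (∀ t, (A t).IsSymm ∧ IsUnit (A t)) ∧
      Qᵀ * C 1 * Q = Matrix.reindex e e (Matrix.blockDiagonal' A) ∧
      Qᵀ * C k * Q = Matrix.reindex e e (Matrix.blockDiagonal' fun t => β t • A t) ∧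
      (∀ i, 2 ≤ i → i ≤ m → i ≠ k →
        (∀ t, (B i t).IsSymm) ∧
        Qᵀ * C i * Q = Matrix.reindex e e (Matrix.blockDiagonal' (B i))) ∧
      Function.Injective β ∧
      spectrum ℝ ((C 1)⁻¹ * C k) = Set.range β := by
  obtain ⟨Q, hQ, hQd⟩ := hdiag
  have hdet := (isUnit_iff_isUnit_det Q).mp hQ
  have hdet1 := (isUnit_iff_isUnit_det (C 1)).mp h1
  set M := (C 1)⁻¹ * C k with hM
  obtain ⟨d, hd⟩ : ∃ d, diagonal d = Q⁻¹ * M * Q := ⟨_, hQd.diagonal_diag⟩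
  have hMQ : M * Q = Q * diagonal d := by
    rw [hd, Matrix.mul_assoc Q⁻¹, mul_nonsing_inv_cancel_left _ _ hdet]
  have hCM : C 1 * M = C k := mul_nonsing_inv_cancel_left _ _ hdet1
  have hspec : spectrum ℝ M = Set.range d := by
    obtain ⟨u, rfl⟩ := hQ
    rw [← spectrum_diagonal, hd, ← coe_units_inv]
    exact (spectrum.units_conjugate' (u := u)).symm
  obtain ⟨r, f, β, hf, hβ, hβf⟩ := exists_surjective_fin_injective d
  let e : (Σ t : Fin r, Fin (Fintype.card {i // f i = t})) ≃ Fin n :=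
    (Equiv.sigmaCongrRight fun t => (Fintype.equivFin {i // f i = t}).symm).trans
      (Equiv.sigmaFiberEquiv f)
  have he : ∀ x, f (e x) = x.1 := fun x => ((Fintype.equivFin {i // f i = x.1}).symm x.2).2
  have hblock {S : Matrix (Fin n) (Fin n) ℝ} (hS : S.IsSymm) (hSM : (S * M).IsSymm) :=
    eq_reindex_blockDiagonal' e he (T := Qᵀ * S * Q) fun i j hij =>
      transpose_mul_mul_apply_eq_zero hS hSM hMQ fun h => hij (hβ (by rw [hβf, hβf, h]))
  have hsub {S : Matrix (Fin n) (Fin n) ℝ} (hS : S.IsSymm) (t : Fin r) :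
      ((Qᵀ * S * Q).submatrix (fun x => e ⟨t, x⟩) fun x => e ⟨t, x⟩).IsSymm :=
    (isSymm_transpose_mul_mul_self Q hS).submatrix _
  have hs1 := hsymm 1 le_rfl (by omega)
  have hsk := hsymm k (by omega) hkm
  have hb1 := hblock hs1 (hCM ▸ hsk)
  refine ⟨r, fun t => Fintype.card {i // f i = t}, ?_, e, Q, hQ,
    fun t => (Qᵀ * C 1 * Q).submatrix (fun x => e ⟨t, x⟩) fun x => e ⟨t, x⟩, β,
    fun i t => (Qᵀ * C i * Q).submatrix (fun x => e ⟨t, x⟩) fun x => e ⟨t, x⟩,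
    fun t => ⟨hsub hs1 t, ?_⟩, hb1, ?_, ?_, hβ, ?_⟩
  · simpa using Fintype.card_congr e
  · have hu : IsUnit (Qᵀ * C 1 * Q) := (((isUnit_transpose Q).mpr hQ).mul h1).mul hQ
    rw [hb1, isUnit_iff_isUnit_det, det_reindex_self, ← isUnit_iff_isUnit_det] at hu
    exact isUnit_of_isUnit_blockDiagonal' hu t
  · have hTk : Qᵀ * C k * Q = Qᵀ * C 1 * Q * diagonal d := by
      simp only [← hCM, Matrix.mul_assoc, hMQ]
    have hkk : (C k * M).IsSymm := by
      rw [IsSymm, hM, transpose_mul, transpose_mul, transpose_nonsing_inv, hs1, hsk,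
        Matrix.mul_assoc]
    refine (hblock hsk hkk).trans ?_
    congr 2
    ext t x y
    simp only [hTk, submatrix_apply, mul_diagonal, Matrix.smul_apply, smul_eq_mul, ← hβf, he]
    ring
  · intro i hi him hik
    have hsi := hsymm i (by omega) him
    exact ⟨hsub hsi, hblock hsi (hsym2 i hi him hik)⟩
  · rw [hspec, ← hf.range_comp β]
    congr 1
    ext i
    exact (hβf i).symm
end

section
/- Let C¹ and C² be n×n real symmetric matrices with C¹ nonsingular. Then C¹ and C² are simultaneously diagonalizable via congruence if and only if there is a nonsingular real matrix P such that P⁻¹(C¹)⁻¹C²P is a real diagonal matrix. -/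
open Matrix

/-- A real symmetric matrix commuting with a diagonal matrix can be diagonalized by congruence
with an invertible matrix which commutes with the same diagonal matrix. -/
theorem Matrix.IsSymm.exists_isUnit_commute_diagonal_isDiag {ι : Type*} [Fintype ι]
    [DecidableEq ι] {A : Matrix ι ι ℝ} (hA : A.IsSymm) {d : ι → ℝ}
    (hd : Commute A (diagonal d)) :
    ∃ Q : Matrix ι ι ℝ, IsUnit Q ∧ Commute Q (diagonal d) ∧ (Qᵀ * A * Q).IsDiag := by
  classical
  let e : (Σ y : Set.range d, {i // Set.rangeFactorization d i = y}) ≃ ι :=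
    Equiv.sigmaFiberEquiv _
  have hde (p) : d (e p) = p.1 := congrArg Subtype.val p.2.2
  let M (y : Set.range d) : Matrix {i // Set.rangeFactorization d i = y}
      {i // Set.rangeFactorization d i = y} ℝ :=
    A.submatrix Subtype.val Subtype.val
  have hM (y) : (M y).IsHermitian := by
    ext i j
    exact hA.apply _ _
  have hAM : A.submatrix e e = blockDiagonal' M := by
    ext ⟨y, i⟩ ⟨z, j⟩
    by_cases hyz : y = z
    · subst hyz
      rw [blockDiagonal'_apply_eq]
      rfl
    · rw [blockDiagonal'_apply_ne _ _ _ hyz]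
      have key := congrFun₂ hd.eq (e ⟨y, i⟩) (e ⟨z, j⟩)
      rw [mul_diagonal, diagonal_mul, hde, hde, mul_comm, ← sub_eq_zero, ← sub_mul] at key
      refine (mul_eq_zero.1 key).resolve_left fun h => hyz (Subtype.ext (sub_eq_zero.1 h).symm)
  let U (y : Set.range d) : Matrix {i // Set.rangeFactorization d i = y}
      {i // Set.rangeFactorization d i = y} ℝ := (hM y).eigenvectorUnitary
  have hU (y) : (U y)ᵀ * U y = 1 := by
    have := Unitary.coe_star_mul_self (hM y).eigenvectorUnitary
    rwa [star_eq_conjTranspose, conjTranspose_eq_transpose_of_trivial] at this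
  have hUM (y) : (U y)ᵀ * M y * U y = diagonal (hM y).eigenvalues := by
    have := (hM y).conjStarAlgAut_star_eigenvectorUnitary
    rw [Unitary.conjStarAlgAut_star_apply, star_eq_conjTranspose,
      conjTranspose_eq_transpose_of_trivial] at this
    exact this
  have hA' : A = (blockDiagonal' M).submatrix e.symm e.symm := by
    rw [← hAM]; simp
  refine ⟨(blockDiagonal' U).submatrix e.symm e.symm, ?_, ?_, ?_⟩
  · refine IsUnit.of_mul_eq_one_right ((blockDiagonal' U)ᵀ.submatrix e.symm e.symm) ?_
    rw [submatrix_mul_equiv, blockDiagonal'_transpose, ← blockDiagonal'_mul]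
    simp_rw [hU]
    exact (congrArg (Matrix.submatrix · e.symm e.symm) blockDiagonal'_one).trans (submatrix_one_equiv _)
  · ext i j
    rw [mul_diagonal, diagonal_mul, mul_comm]
    obtain ⟨⟨y, i⟩, rfl⟩ := e.surjective i
    obtain ⟨⟨z, j⟩, rfl⟩ := e.surjective j
    by_cases hyz : y = z
    · subst hyz
      rw [hde, hde]
    · simp [blockDiagonal'_apply_ne _ _ _ hyz]
  · rw [hA', transpose_submatrix, submatrix_mul_equiv, submatrix_mul_equiv,
      blockDiagonal'_transpose, ← blockDiagonal'_mul, ← blockDiagonal'_mul]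
    simp_rw [hUM]
    rw [blockDiagonal'_diagonal]
    exact (isDiag_diagonal _).submatrix e.symm.injective

/-- A nonsingular symmetric pair `C¹, C²` (with `C¹` invertible) is
simultaneously diagonalizable via congruence if and only if there is a nonsingular real
matrix `P` such that `P⁻¹ (C¹)⁻¹ C² P` is a real diagonal matrix. -/
theorem stmt_2 {n : ℕ} (C1 C2 : Matrix (Fin n) (Fin n) ℝ)
    (h1 : C1.IsSymm) (h2 : C2.IsSymm) (hns : IsUnit C1) :
    (∃ P : Matrix (Fin n) (Fin n) ℝ, IsUnit P ∧
        (Pᵀ * C1 * P).IsDiag ∧ (Pᵀ * C2 * P).IsDiag) ↔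
      (∃ P : Matrix (Fin n) (Fin n) ℝ, IsUnit P ∧
        (P⁻¹ * (C1⁻¹ * C2) * P).IsDiag) := by
  have hC : C1 * C1⁻¹ = 1 := mul_nonsing_inv _ ((isUnit_iff_isUnit_det _).1 hns)
  constructor
  · rintro ⟨P, hP, hD1, hD2⟩
    refine ⟨P, hP, ?_⟩
    have hPt : Pᵀ⁻¹ * Pᵀ = 1 :=
      nonsing_inv_mul _ (by rw [det_transpose]; exact (isUnit_iff_isUnit_det _).1 hP)
    have key : P⁻¹ * (C1⁻¹ * C2) * P = (Pᵀ * C1 * P)⁻¹ * (Pᵀ * C2 * P) := by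
      rw [Matrix.mul_inv_rev, Matrix.mul_inv_rev]
      calc P⁻¹ * (C1⁻¹ * C2) * P = P⁻¹ * (C1⁻¹ * (1 * C2)) * P := by rw [one_mul]
        _ = _ := by rw [← hPt]; simp only [mul_assoc]
    rw [key, ← hD1.diagonal_diag, ← hD2.diagonal_diag, inv_diagonal, diagonal_mul_diagonal]
    exact isDiag_diagonal _
  · rintro ⟨P, hP, hD⟩
    have hPP : P * P⁻¹ = 1 := mul_nonsing_inv _ ((isUnit_iff_isUnit_det _).1 hP)
    obtain ⟨d, hd⟩ : ∃ d, diagonal d = P⁻¹ * (C1⁻¹ * C2) * P := ⟨_, hD.diagonal_diag⟩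
    have hA : (Pᵀ * C1 * P).IsSymm := by
      simp [IsSymm, transpose_mul, h1.eq, mul_assoc]
    have hB : (Pᵀ * C2 * P).IsSymm := by
      simp [IsSymm, transpose_mul, h2.eq, mul_assoc]
    have hAB : Pᵀ * C1 * P * diagonal d = Pᵀ * C2 * P := by
      calc Pᵀ * C1 * P * diagonal d = Pᵀ * (C1 * ((P * P⁻¹) * (C1⁻¹ * (C2 * P)))) := by
            rw [hd]; simp only [mul_assoc]
        _ = Pᵀ * ((C1 * C1⁻¹) * (C2 * P)) := by rw [hPP, one_mul, mul_assoc]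
        _ = _ := by rw [hC, one_mul, mul_assoc]
    have hcomm : Commute (Pᵀ * C1 * P) (diagonal d) := by
      have := hB.eq
      rw [← hAB, transpose_mul, diagonal_transpose, hA.eq] at this
      exact this.symm
    obtain ⟨Q, hQ, hQd, hQA⟩ := hA.exists_isUnit_commute_diagonal_isDiag hcomm
    refine ⟨P * Q, hP.mul hQ, ?_, ?_⟩
    · simpa only [transpose_mul, mul_assoc] using hQA
    · have key : (P * Q)ᵀ * C2 * (P * Q) = Qᵀ * (Pᵀ * C1 * P) * Q * diagonal d := by
        rw [mul_assoc _ Q, hQd.eq, mul_assoc Qᵀ, ← mul_assoc _ (diagonal d), hAB]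
        simp only [transpose_mul, mul_assoc]
      rw [key, ← hQA.diagonal_diag, diagonal_mul_diagonal]
      exact isDiag_diagonal _
end

section
/- Let C¹, C², …, C^m be n×n real symmetric matrices with C¹ nonsingular, and suppose there is an index k with 2 ≤ k ≤ m such that (C¹)⁻¹C^k has n distinct real eigenvalues. Then C¹, C², …, C^m are simultaneously diagonalizable via congruence if and only if Cⁱ(C¹)⁻¹C^k is symmetric for every i ∈ {2,…,m} with i ≠ k. -/
open Matrix

namespace Matrix

variable {ι : Type*} [Fintype ι] [DecidableEq ι]

/-- A matrix over a field whose spectrum contains a family of distinct scalars, one for each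
index, is diagonalized by an invertible matrix. -/
theorem exists_isUnit_mul_eq_mul_diagonal {K : Type*} [Field K] (M : Matrix ι ι K) (β : ι → K)
    (hβ : Function.Injective β) (hM : ∀ i, β i ∈ spectrum K M) :
    ∃ P : Matrix ι ι K, IsUnit P ∧ M * P = P * diagonal β := by
  have hev : ∀ i, ∃ v, Module.End.HasEigenvector (toLin' M) (β i) v := fun i =>
    (Module.End.hasEigenvalue_iff_mem_spectrum.2
      (by rw [spectrum_toLin']; exact hM i)).exists_hasEigenvector
  choose v hv using hev
  refine ⟨of fun a i => v i a, ?_, ?_⟩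
  · rw [← linearIndependent_cols_iff_isUnit]
    exact Module.End.eigenvectors_linearIndependent' (toLin' M) β hβ v hv
  · ext a i
    have h := congrFun (hv i).apply_eq_smul a
    rw [mul_diagonal]
    simpa [toLin'_apply, mulVec, dotProduct, mul_apply, mul_comm] using h

/-- If `P` diagonalizes `M` with distinct eigenvalues, then `P` diagonalizes by congruence every
symmetric `S` such that `S * M` is symmetric. -/
theorem IsSymm.isDiag_transpose_mul_mul {R : Type*} [CommRing R] [IsDomain R]
    {S M P : Matrix ι ι R} {β : ι → R} (hβ : Function.Injective β)
    (hMP : M * P = P * diagonal β) (hS : S.IsSymm) (hSM : (S * M).IsSymm) :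
    (Pᵀ * S * P).IsDiag := by
  have hT : (Pᵀ * S * P).IsSymm := by
    simp [IsSymm, transpose_mul, hS.eq, Matrix.mul_assoc]
  have hTD : (Pᵀ * S * P * diagonal β).IsSymm := by
    have h : Pᵀ * S * P * diagonal β = Pᵀ * (S * M) * P := by
      simp only [Matrix.mul_assoc, hMP]
    rw [h, IsSymm, transpose_mul, transpose_mul, hSM.eq, transpose_transpose,
      ← Matrix.mul_assoc]
  intro i j hij
  have h := hTD.apply i j
  rw [mul_diagonal, mul_diagonal, hT.apply i j] at h
  have h0 : (Pᵀ * S * P) i j * (β i - β j) = 0 := by rw [mul_sub, h, sub_self]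
  exact (mul_eq_zero.1 h0).resolve_right (sub_ne_zero.2 (hβ.ne hij))

/-- If `A`, `X`, `Y` are simultaneously diagonalized via congruence by an invertible matrix, then `X * A⁻¹ * Y` is symmetric. -/
theorem isSymm_mul_inv_mul_of_isDiag {R : Type*} [CommRing R] {A X Y P : Matrix ι ι R}
    (hP : IsUnit P) (hA : (Pᵀ * A * P).IsDiag) (hX : (Pᵀ * X * P).IsDiag)
    (hY : (Pᵀ * Y * P).IsDiag) : (X * (A⁻¹ * Y)).IsSymm := by
  have hdet : IsUnit P.det := (isUnit_iff_isUnit_det P).1 hP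
  have hdet' : IsUnit Pᵀ.det := by rwa [det_transpose]
  have key : Pᵀ * (X * (A⁻¹ * Y)) * P =
      (Pᵀ * X * P) * ((Pᵀ * A * P)⁻¹ * (Pᵀ * Y * P)) := by
    simp only [mul_inv_rev, Matrix.mul_assoc, mul_nonsing_inv_cancel_left _ _ hdet,
      nonsing_inv_mul_cancel_left _ _ hdet']
  have hsymm : (Pᵀ * (X * (A⁻¹ * Y)) * P).IsSymm := by
    rw [key, ← hX.diagonal_diag, ← hA.diagonal_diag, ← hY.diagonal_diag, inv_diagonal,
      diagonal_mul_diagonal, diagonal_mul_diagonal]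
    exact isSymm_diagonal _
  rw [IsSymm, transpose_mul, transpose_mul, transpose_transpose, ← Matrix.mul_assoc] at hsymm
  exact ((isUnit_iff_isUnit_det _).2 hdet').mul_left_cancel (hP.mul_right_cancel hsymm)

end Matrix

/-- Let `C¹, …, C^m` be `n × n` real symmetric matrices with `C¹` nonsingular
(the collection is indexed by `i ∈ {1, …, m}`), and suppose there is `k` with `2 ≤ k ≤ m`
such that `(C¹)⁻¹ C^k` has `n` distinct real eigenvalues (its spectrum is the range of an
injective map `Fin n → ℝ`).  Then `C¹, …, C^m` are simultaneously diagonalizable via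
congruence if and only if `Cⁱ (C¹)⁻¹ C^k` is symmetric for every `i ∈ {2, …, m}`, `i ≠ k`. -/
theorem stmt_3 {n m : ℕ} (hm : 2 ≤ m) (C : ℕ → Matrix (Fin n) (Fin n) ℝ)
    (hsymm : ∀ i, 1 ≤ i → i ≤ m → (C i).IsSymm)
    (h1 : IsUnit (C 1))
    (k : ℕ) (hk2 : 2 ≤ k) (hkm : k ≤ m)
    (heig : ∃ β : Fin n → ℝ, Function.Injective β ∧
      spectrum ℝ ((C 1)⁻¹ * C k) = Set.range β) :
    (∃ P : Matrix (Fin n) (Fin n) ℝ, IsUnit P ∧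
        ∀ i, 1 ≤ i → i ≤ m → (Pᵀ * C i * P).IsDiag) ↔
      (∀ i, 2 ≤ i → i ≤ m → i ≠ k → (C i * ((C 1)⁻¹ * C k)).IsSymm) := by
  constructor
  · rintro ⟨P, hP, hdiag⟩ i hi him -
    exact isSymm_mul_inv_mul_of_isDiag hP (hdiag 1 le_rfl (by omega)) (hdiag i (by omega) him)
      (hdiag k (by omega) hkm)
  · intro h
    obtain ⟨β, hβ, hspec⟩ := heig
    obtain ⟨P, hP, hMP⟩ := exists_isUnit_mul_eq_mul_diagonal ((C 1)⁻¹ * C k) β hβ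
      fun i => hspec ▸ Set.mem_range_self i
    refine ⟨P, hP, fun i hi him => (hsymm i hi him).isDiag_transpose_mul_mul hβ hMP ?_⟩
    have hCk := hsymm k (by omega) hkm
    rcases eq_or_ne i k with rfl | hik
    · have hC1 := hsymm 1 le_rfl (by omega)
      rw [IsSymm, transpose_mul, transpose_mul, transpose_nonsing_inv, hC1.eq, hCk.eq,
        Matrix.mul_assoc]
    · rcases eq_or_lt_of_le hi with rfl | hi'
      · rwa [mul_nonsing_inv_cancel_left _ _ ((isUnit_iff_isUnit_det _).1 h1)]
      · exact h i hi' him hik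
end

section
/- Let C¹, C², …, C^m be n×n real symmetric matrices with m ≥ 3 and C¹ nonsingular. Then C¹, C², …, C^m are simultaneously diagonalizable via congruence if and only if for each i ∈ {2,…,m} the matrix (C¹)⁻¹Cⁱ is real similarly diagonalizable and Cʲ(C¹)⁻¹Cⁱ is symmetric for all 2 ≤ i < j ≤ m. -/
open Matrix

namespace Module.End

variable {K V ι : Type*} [Field K] [AddCommGroup V] [Module K V]

/-- The generalized eigenspaces of a diagonalizable endomorphism are its eigenspaces. -/
lemma maxGenEigenspace_eq_eigenspace_of_iSup_eigenspace_eq_top {f : End K V}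
    (hf : ⨆ μ, f.eigenspace μ = ⊤) (μ : K) : f.maxGenEigenspace μ = f.eigenspace μ := by
  have hle (ν : K) : f.eigenspace ν ≤ f.maxGenEigenspace ν :=
    (f.genEigenspace ν).monotone le_top
  have hdisj : Disjoint (f.maxGenEigenspace μ) (⨆ (ν) (_ : ν ≠ μ), f.eigenspace ν) :=
    (f.independent_maxGenEigenspace μ).mono_right (iSup₂_mono fun ν _ => hle ν)
  have htop : f.eigenspace μ ⊔ ⨆ (ν) (_ : ν ≠ μ), f.eigenspace ν = ⊤ := by
    rw [← hf]
    refine le_antisymm (sup_le (le_iSup _ μ) (iSup₂_le fun ν _ => le_iSup f.eigenspace ν))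
      (iSup_le fun ν => ?_)
    by_cases h : ν = μ
    · exact h ▸ le_sup_left
    · exact le_sup_of_le_right (le_iSup₂_of_le ν h le_rfl)
  calc f.maxGenEigenspace μ
      = (f.eigenspace μ ⊔ ⨆ (ν) (_ : ν ≠ μ), f.eigenspace ν) ⊓ f.maxGenEigenspace μ := by
        rw [htop, top_inf_eq]
    _ = f.eigenspace μ ⊔ (⨆ (ν) (_ : ν ≠ μ), f.eigenspace ν) ⊓ f.maxGenEigenspace μ :=
        sup_inf_assoc_of_le _ (hle μ)
    _ = f.eigenspace μ := by rw [inf_comm, hdisj.eq_bot, sup_bot_eq]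

/-- Commuting diagonalizable endomorphisms, self-adjoint for a symmetric bilinear form, have a
common eigenbasis that is orthogonal for the form. -/
theorem exists_isOrthoᵢ_basis_forall_apply_eq_smul [FiniteDimensional K V] [Invertible (2 : K)]
    {B : LinearMap.BilinForm K V} (hB : B.IsSymm) (f : ι → End K V)
    (hcomm : Pairwise fun i j => Commute (f i) (f j))
    (hdiag : ∀ i, ⨆ μ, (f i).eigenspace μ = ⊤)
    (hadj : ∀ i x y, B (f i x) y = B x (f i y)) :
    ∃ b : Basis (Fin (finrank K V)) K V, B.IsOrthoᵢ b ∧ ∀ i k, ∃ μ : K, f i (b k) = μ • b k := by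
  classical
  have hgen (i : ι) (μ : K) : (f i).maxGenEigenspace μ = (f i).eigenspace μ :=
    maxGenEigenspace_eq_eigenspace_of_iSup_eigenspace_eq_top (hdiag i) μ
  have htop : ⨆ χ : ι → K, ⨅ i, (f i).eigenspace (χ i) = ⊤ := by
    simpa only [hgen] using
      iSup_iInf_maxGenEigenspace_eq_top_of_iSup_maxGenEigenspace_eq_top_of_commute f hcomm
        (by simpa only [hgen] using hdiag)
  have hind : iSupIndep fun χ : ι → K => ⨅ i, (f i).eigenspace (χ i) := by
    simpa only [hgen] using independent_iInf_maxGenEigenspace_of_forall_mapsTo f fun i j =>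
      mapsTo_maxGenEigenspace_of_comm <| by
        rcases eq_or_ne j i with rfl | hij
        · exact Commute.refl _
        · exact hcomm hij
  have hint := DirectSum.isInternal_submodule_of_iSupIndep_of_iSup_eq_top hind htop
  choose v hv using fun χ : ι → K =>
    LinearMap.BilinForm.exists_orthogonal_basis <|
      LinearMap.BilinForm.isSymm_iff.mp (hB.restrict (⨅ i, (f i).eigenspace (χ i)))
  let c := hint.collectedBasis v
  have hc (a) (i : ι) : f i (c a) = a.1 i • c a :=
    mem_eigenspace_iff.mp <| (Submodule.mem_iInf _).mp (hint.collectedBasis_mem v a) i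
  have hortho : ∀ a a', a ≠ a' → B (c a) (c a') = 0 := by
    intro a a' hne
    by_cases hχ : a.1 = a'.1
    · obtain ⟨χ, k⟩ := a
      obtain ⟨χ', k'⟩ := a'
      obtain rfl : χ = χ' := hχ
      have hk : k ≠ k' := fun h => hne (h ▸ rfl)
      simpa [c] using LinearMap.isOrthoᵢ_def.mp (hv χ) k k' hk
    · obtain ⟨i, hi⟩ := Function.ne_iff.mp hχ
      have h := hadj i (c a) (c a')
      simp only [hc, map_smul, LinearMap.smul_apply, smul_eq_mul] at h
      exact (mul_eq_mul_right_iff.mp h).resolve_left hi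
  have := FiniteDimensional.fintypeBasisIndex c
  let e := Fintype.equivFinOfCardEq (finrank_eq_card_basis c).symm
  refine ⟨c.reindex e, LinearMap.isOrthoᵢ_def.mpr fun k l hkl => ?_, fun i k => ⟨(e.symm k).1 i, ?_⟩⟩
  · simpa using hortho _ _ (e.symm.injective.ne hkl)
  · simpa using hc (e.symm k) i

end Module.End

namespace Matrix

variable {ι K : Type*} [Fintype ι] [DecidableEq ι] [Field K]

lemma IsDiag.mul {A B : Matrix ι ι K} (hA : A.IsDiag) (hB : B.IsDiag) : (A * B).IsDiag := by
  rw [← hA.diagonal_diag, ← hB.diagonal_diag, diagonal_mul_diagonal]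
  exact isDiag_diagonal _

lemma IsDiag.inv {A : Matrix ι ι K} (hA : A.IsDiag) : A⁻¹.IsDiag := by
  rw [← hA.diagonal_diag, inv_diagonal]
  exact isDiag_diagonal _

/-- The eigenspaces of a matrix similar to a diagonal one span the whole space. -/
lemma iSup_eigenspace_toLin'_eq_top {A Q : Matrix ι ι K} (hQ : IsUnit Q)
    (hA : (Q⁻¹ * A * Q).IsDiag) : ⨆ μ, Module.End.eigenspace (toLin' A) μ = ⊤ := by
  have hdet := (isUnit_iff_isUnit_det Q).mp hQ
  have hAQ : A * Q = Q * diagonal (Q⁻¹ * A * Q).diag := by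
    rw [hA.diagonal_diag, mul_assoc, mul_nonsing_inv_cancel_left _ _ hdet]
  rw [eq_top_iff]
  intro x _
  rw [show x = ∑ k, (Q⁻¹ *ᵥ x) k • Q.col k by
    simpa [mul_nonsing_inv _ hdet, mulVec_mulVec, col_def] using mulVec_eq_sum (Q⁻¹ *ᵥ x) Q]
  refine Submodule.sum_mem _ fun k _ => Submodule.smul_mem _ _ <|
    Submodule.mem_iSup_of_mem ((Q⁻¹ * A * Q).diag k) <| Module.End.mem_eigenspace_iff.mpr ?_
  ext i
  have h := congrFun₂ hAQ i k
  rw [mul_diagonal, mul_comm (Q i k), mul_apply] at h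
  exact h

lemma inv_congr_mul_congr {P A B : Matrix ι ι K} (hP : IsUnit P) :
    (Pᵀ * A * P)⁻¹ * (Pᵀ * B * P) = P⁻¹ * (A⁻¹ * B) * P := by
  have hPt : IsUnit Pᵀ.det := by rw [det_transpose]; exact (isUnit_iff_isUnit_det P).mp hP
  simp only [mul_inv_rev, mul_assoc]
  rw [nonsing_inv_mul_cancel_left _ _ hPt]

end Matrix

/-- Let `C¹, …, C^m` be `n × n` real symmetric matrices, `m ≥ 3`, `C¹`
nonsingular (the collection is indexed by `i ∈ {1, …, m}`).  Then `C¹, …, C^m` are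
simultaneously diagonalizable via congruence if and only if for each `i ∈ {2, …, m}` the
matrix `(C¹)⁻¹ Cⁱ` is real similarly diagonalizable and `Cʲ (C¹)⁻¹ Cⁱ` is symmetric for
all `2 ≤ i < j ≤ m`. -/
theorem stmt_7 {n m : ℕ} (hm : 3 ≤ m) (C : ℕ → Matrix (Fin n) (Fin n) ℝ)
    (hsymm : ∀ i, 1 ≤ i → i ≤ m → (C i).IsSymm)
    (h1 : IsUnit (C 1)) :
    (∃ P : Matrix (Fin n) (Fin n) ℝ, IsUnit P ∧
        ∀ i, 1 ≤ i → i ≤ m → (Pᵀ * C i * P).IsDiag) ↔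
      ((∀ i, 2 ≤ i → i ≤ m → SimilarlyDiagonalizable ((C 1)⁻¹ * C i)) ∧
        (∀ i j, 2 ≤ i → i < j → j ≤ m → (C j * ((C 1)⁻¹ * C i)).IsSymm)) := by
  have hdet1 := (isUnit_iff_isUnit_det _).mp h1
  have hC1 : (C 1)ᵀ = C 1 := hsymm 1 le_rfl (by lia)
  constructor
  · rintro ⟨P, hP, hD⟩
    have hdiag (i) (hi : 2 ≤ i) (him : i ≤ m) : (P⁻¹ * ((C 1)⁻¹ * C i) * P).IsDiag := by
      rw [← inv_congr_mul_congr hP]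
      exact (hD 1 le_rfl (by lia)).inv.mul (hD i (by lia) him)
    refine ⟨fun i hi him => ⟨P, hP, hdiag i hi him⟩, fun i j hi hij hjm => ?_⟩
    have hPdet := (isUnit_iff_isUnit_det P).mp hP
    have hPt : IsUnit Pᵀ := (isUnit_transpose P).mpr hP
    have hsym := ((hD j (by lia) hjm).mul (hdiag i hi (by lia))).isSymm
    have hprod : Pᵀ * C j * P * (P⁻¹ * ((C 1)⁻¹ * C i) * P) =
        Pᵀ * (C j * ((C 1)⁻¹ * C i)) * P := by
      simp only [mul_assoc]
      rw [mul_nonsing_inv_cancel_left _ _ hPdet]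
    rw [hprod, IsSymm, transpose_mul, transpose_mul, transpose_transpose, ← mul_assoc] at hsym
    exact hPt.mul_left_cancel (hP.mul_right_cancel hsym)
  · rintro ⟨hsim, hsy⟩
    let f : {i // 2 ≤ i ∧ i ≤ m} → Module.End ℝ (Fin n → ℝ) := fun i => toLin' ((C 1)⁻¹ * C i)
    have hswap (i j) (hi : 2 ≤ i) (hij : i < j) (hjm : j ≤ m) :
        Commute ((C 1)⁻¹ * C i) ((C 1)⁻¹ * C j) := by
      have h := hsy i j hi hij hjm
      rw [IsSymm, transpose_mul, transpose_mul, transpose_nonsing_inv, hC1,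
        hsymm i (by lia) (by lia), hsymm j (by lia) hjm] at h
      simp only [Commute, SemiconjBy, mul_assoc] at h ⊢
      rw [h]
    have hcomm : Pairwise fun i j => Commute (f i) (f j) := by
      rintro ⟨i, hi, him⟩ ⟨j, hj, hjm⟩ hne
      have hc : Commute ((C 1)⁻¹ * C i) ((C 1)⁻¹ * C j) := by
        rcases lt_or_gt_of_ne (fun h => hne (Subtype.ext h) : i ≠ j) with h | h
        · exact hswap i j hi h hjm
        · exact (hswap j i hj h him).symm
      exact hc.map toLinAlgEquiv'
    have hB : (C 1).toBilin'.IsSymm := ⟨fun x y => by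
      simp only [toBilin'_apply']
      rw [dotProduct_mulVec, ← mulVec_transpose, hC1, dotProduct_comm]⟩
    have hform (i : {i // 2 ≤ i ∧ i ≤ m}) (x y : Fin n → ℝ) :
        (C 1).toBilin' x (f i y) = x ⬝ᵥ C i *ᵥ y := by
      simp only [f, toBilin'_apply', toLin'_apply, mulVec_mulVec]
      rw [mul_nonsing_inv_cancel_left _ _ hdet1]
    have hadj (i x y) : (C 1).toBilin' (f i x) y = (C 1).toBilin' x (f i y) := by
      have hCi : (C i)ᵀ = C i := hsymm i (by lia) i.2.2
      rw [hB.eq, hform, hform, dotProduct_mulVec, ← mulVec_transpose, hCi, dotProduct_comm]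
    obtain ⟨b, hb, hev⟩ := Module.End.exists_isOrthoᵢ_basis_forall_apply_eq_smul hB f hcomm
      (fun i => by
        obtain ⟨Q, hQ, hD⟩ := hsim i i.2.1 i.2.2
        exact iSup_eigenspace_toLin'_eq_top hQ hD) hadj
    let c := b.reindex (finCongr (Module.finrank_fin_fun ℝ))
    have hentry (A : Matrix (Fin n) (Fin n) ℝ) (k l) :
        (((Pi.basisFun ℝ (Fin n)).toMatrix c)ᵀ * A * (Pi.basisFun ℝ (Fin n)).toMatrix c) k l =
          c k ⬝ᵥ A *ᵥ c l := by
      rw [mul_assoc]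
      simp [mul_apply, dotProduct, mulVec, Module.Basis.toMatrix_apply]
    have hortho (k l) (hkl : k ≠ l) : (C 1).toBilin' (c k) (c l) = 0 := by
      simpa [c] using
        LinearMap.isOrthoᵢ_def.mp hb _ _ ((finCongr (Module.finrank_fin_fun ℝ)).symm.injective.ne hkl)
    refine ⟨(Pi.basisFun ℝ (Fin n)).toMatrix c, ?_, fun i hi him k l hkl => ?_⟩
    · let _ := (Pi.basisFun ℝ (Fin n)).invertibleToMatrix c
      exact isUnit_of_invertible _
    refine (hentry (C i) k l).trans ?_
    rcases hi.eq_or_lt with rfl | hi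
    · rw [← toBilin'_apply']
      exact hortho k l hkl
    · obtain ⟨μ, hμ⟩ : ∃ μ : ℝ, f ⟨i, hi, him⟩ (c l) = μ • c l := by
        simpa [c] using hev ⟨i, hi, him⟩ _
      rw [← hform ⟨i, hi, him⟩, hμ, map_smul, hortho k l hkl, smul_zero]
end

section
/- Let C¹, C², …, C^m be n×n real symmetric matrices with C¹ nonsingular. If C¹, C², …, C^m are simultaneously diagonalizable via congruence, then for all indices i, j ∈ {2,…,m} the matrix Cʲ(C¹)⁻¹Cⁱ is symmetric, and for each i ∈ {2,…,m} the matrix (C¹)⁻¹Cⁱ is real similarly diagonalizable. -/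
open Matrix

/-- The inverse of a diagonal matrix is diagonal. -/
theorem Matrix.IsDiag.nonsing_inv {ι K : Type*} [Fintype ι] [DecidableEq ι] [CommRing K]
    {A : Matrix ι ι K} (hA : A.IsDiag) : A⁻¹.IsDiag := by
  rw [← hA.diagonal_diag, inv_diagonal]
  exact isDiag_diagonal _

/-- The product of two diagonal matrices is diagonal. -/
theorem Matrix.IsDiag.mul_isDiag {ι K : Type*} [Fintype ι] [DecidableEq ι] [Semiring K]
    {A B : Matrix ι ι K} (hA : A.IsDiag) (hB : B.IsDiag) : (A * B).IsDiag := by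
  rw [← hA.diagonal_diag, ← hB.diagonal_diag, diagonal_mul_diagonal]
  exact isDiag_diagonal _

/-- Congruence by a nonsingular matrix reflects symmetry. -/
theorem Matrix.IsSymm.of_congruence {ι K : Type*} [Fintype ι] [DecidableEq ι] [CommRing K]
    {A P : Matrix ι ι K} (hP : IsUnit P) (h : (Pᵀ * A * P).IsSymm) : A.IsSymm := by
  have hPt : IsUnit Pᵀ := (isUnit_transpose P).2 hP
  refine hPt.mul_left_cancel (hP.mul_right_cancel ?_)
  simpa [IsSymm, transpose_mul, Matrix.mul_assoc] using h

/-- Conjugating `A⁻¹ * B` by `P` amounts to applying the congruence by `P` to `A` and `B`. -/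
theorem Matrix.inv_congruence_mul_congruence {ι K : Type*} [Fintype ι] [DecidableEq ι]
    [CommRing K] (A B : Matrix ι ι K) {P : Matrix ι ι K} (hP : IsUnit P) :
    (Pᵀ * A * P)⁻¹ * (Pᵀ * B * P) = P⁻¹ * (A⁻¹ * B) * P := by
  have hPt : IsUnit Pᵀ.det := (isUnit_iff_isUnit_det _).1 ((isUnit_transpose P).2 hP)
  simp only [mul_inv_rev, Matrix.mul_assoc, nonsing_inv_mul_cancel_left _ _ hPt]

/-- Let `C¹, …, C^m` be `n × n` real symmetric matrices with `C¹` nonsingular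
(the collection is indexed by `i ∈ {1, …, m}`).  If `C¹, …, C^m` are simultaneously
diagonalizable via congruence, then for all `i, j ∈ {2, …, m}` the matrix `Cʲ (C¹)⁻¹ Cⁱ`
is symmetric, and for each `i ∈ {2, …, m}` the matrix `(C¹)⁻¹ Cⁱ` is real similarly
diagonalizable. -/
theorem stmt_8 {n m : ℕ} (C : ℕ → Matrix (Fin n) (Fin n) ℝ)
    (hsymm : ∀ i, 1 ≤ i → i ≤ m → (C i).IsSymm)
    (h1 : IsUnit (C 1))
    (hSDC : ∃ P : Matrix (Fin n) (Fin n) ℝ, IsUnit P ∧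
      ∀ i, 1 ≤ i → i ≤ m → (Pᵀ * C i * P).IsDiag) :
    (∀ i j, 2 ≤ i → i ≤ m → 2 ≤ j → j ≤ m → (C j * ((C 1)⁻¹ * C i)).IsSymm) ∧
      (∀ i, 2 ≤ i → i ≤ m → SimilarlyDiagonalizable ((C 1)⁻¹ * C i)) := by
  obtain ⟨P, hP, hD⟩ := hSDC
  have hdiag : ∀ i, 2 ≤ i → i ≤ m → (P⁻¹ * ((C 1)⁻¹ * C i) * P).IsDiag := by
    intro i hi him
    rw [← inv_congruence_mul_congruence (C 1) (C i) hP]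
    exact (hD 1 le_rfl (by omega)).nonsing_inv.mul_isDiag (hD i (by omega) him)
  refine ⟨fun i j hi him hj hjm => IsSymm.of_congruence hP ?_,
    fun i hi him => ⟨P, hP, hdiag i hi him⟩⟩
  have hPdet : IsUnit P.det := (isUnit_iff_isUnit_det _).1 hP
  have h := (hD j (by omega) hjm).mul_isDiag (hdiag i hi him)
  simp only [Matrix.mul_assoc, mul_nonsing_inv_cancel_left _ _ hPdet] at h
  simpa only [Matrix.mul_assoc] using h.isSymm
end

section
/- Let p ≥ 1, r ≥ 1, 0 ≤ s ≤ r, and n = p + r. For i = 1, …, m−1 let C̄ⁱ = diag(Cⁱ₁, 0_s, 0_{r−s}) where each Cⁱ₁ is a real diagonal p×p matrix and C^{m−1}₁ is nonsingular, and let C̄^m = diag(C^m₁, C^m₆, 0_{r−s}) where C^m₁ is a real symmetric p×p matrix and C^m₆ is a nonsingular real diagonal s×s matrix. Then C̄¹, C̄², …, C̄^m are simultaneously diagonalizable via congruence if and only if the north-west blocks C¹₁, C²₁, …, C^m₁ are simultaneously diagonalizable via congruence. -/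
open Matrix

/-- The canonical identification of `Fin p ⊕ (Fin q ⊕ Fin r)` with `Fin n`
when `p + q + r = n`, used to realize `3 × 3` block matrices as `n × n` matrices. -/
def tripleEquiv (p q r n : ℕ) (h : p + q + r = n) :
    (Fin p ⊕ (Fin q ⊕ Fin r)) ≃ Fin n :=
  (Equiv.sumCongr (Equiv.refl (Fin p)) finSumFinEquiv).trans
    (finSumFinEquiv.trans (finCongr (by omega)))

namespace Matrix

variable {K α β γ : Type*} [Field K]

section Forward

variable [Fintype α] [DecidableEq α] [Fintype β] [DecidableEq β]

/-- If congruence by a nonsingular `P` diagonalizes `diag(B, 0)` with `B` nonsingular, then some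
columns of `P`, cut down to the first block of rows, form a nonsingular matrix, and all the other
columns vanish on that block of rows. -/
theorem exists_columns_of_isDiag_congr {P : Matrix (α ⊕ β) (α ⊕ β) K} (hP : IsUnit P)
    {B : Matrix α α K} (hB : IsUnit B) (h : (Pᵀ * fromBlocks B 0 0 0 * P).IsDiag) :
    ∃ f : α → α ⊕ β, Function.Injective f ∧ IsUnit (P.submatrix Sum.inl f) ∧
      ∀ j ∉ Set.range f, ∀ a, P (Sum.inl a) j = 0 := by
  set X : Matrix α (α ⊕ β) K := P.submatrix Sum.inl id with hX
  have hXB : Pᵀ * fromBlocks B 0 0 0 * P = Xᵀ * B * X := by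
    ext i j
    simp [hX, mul_apply, Fintype.sum_sum_type]
  rw [hXB] at h
  set D : Matrix (α ⊕ β) (α ⊕ β) K := Xᵀ * B * X with hD
  have hdiag : diagonal D.diag = D := h.diagonal_diag
  obtain ⟨R, hR⟩ : ∃ R : Matrix (α ⊕ β) α K, X * R = 1 := by
    refine ⟨P⁻¹.submatrix id Sum.inl, ?_⟩
    have hPP : P * P⁻¹ = 1 := mul_nonsing_inv P ((isUnit_iff_isUnit_det P).1 hP)
    ext i j
    have := congr_fun₂ hPP (Sum.inl i) (Sum.inl j)
    simpa [hX, mul_apply, one_apply] using this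
  have hBD : Rᵀ * D * R = B := by
    calc Rᵀ * D * R = (X * R)ᵀ * B * (X * R) := by
          simp only [hD, transpose_mul, Matrix.mul_assoc]
      _ = B := by simp [hR]
  have hrankB : B.rank = Fintype.card α := rank_of_isUnit B hB
  have hrank : D.rank = Fintype.card α := by
    refine le_antisymm ?_ ?_
    · exact (rank_mul_le_right _ _).trans (rank_le_card_height X)
    · rw [← hrankB]
      conv_lhs => rw [← hBD]
      exact (rank_mul_le_left _ _).trans (rank_mul_le_right _ _)
  classical
  rw [← hdiag, rank_diagonal] at hrank
  let f : α ≃ {j // D.diag j ≠ 0} := Fintype.equivOfCardEq hrank.symm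
  have hf : Function.Injective fun a => (f a : α ⊕ β) :=
    Subtype.val_injective.comp f.injective
  have hQ : IsUnit (P.submatrix Sum.inl fun a => (f a : α ⊕ β)) := by
    set Q := P.submatrix Sum.inl fun a => (f a : α ⊕ β) with hQdef
    have hQD : Qᵀ * B * Q = diagonal fun a => D.diag (f a) := by
      have : Qᵀ * B * Q = D.submatrix (fun a => (f a : α ⊕ β)) fun a => (f a : α ⊕ β) := by
        ext i j
        simp [hD, hX, hQdef, mul_apply]
      rw [this]
      exact (h.submatrix hf).diagonal_diag.symm
    have hdet := congr_arg det hQD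
    rw [det_mul, det_diagonal] at hdet
    rw [isUnit_iff_isUnit_det, isUnit_iff_ne_zero]
    intro h0
    rw [h0, mul_zero] at hdet
    exact Finset.prod_ne_zero_iff.2 (fun a _ => (f a).2) hdet.symm
  refine ⟨fun a => f a, hf, hQ, ?_⟩
  intro j hj a
  have hDj : D.diag j = 0 := by
    by_contra hne
    exact hj ⟨f.symm ⟨j, hne⟩, congr_arg Subtype.val (f.apply_symm_apply _)⟩
  have hcol : D *ᵥ Pi.single j 1 = 0 := by
    rw [← hdiag, diagonal_mulVec_single, hDj, zero_mul, Pi.single_zero]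
  have hXcol : X *ᵥ Pi.single j 1 = 0 := by
    have hinj : Function.Injective (Xᵀ * B).mulVec := by
      have hleft : B⁻¹ * Rᵀ * (Xᵀ * B) = 1 := by
        rw [Matrix.mul_assoc, ← Matrix.mul_assoc Rᵀ, ← transpose_mul, hR]
        simp [nonsing_inv_mul B ((isUnit_iff_isUnit_det B).1 hB)]
      intro v w hvw
      simpa [mulVec_mulVec, hleft] using congr_arg ((B⁻¹ * Rᵀ) *ᵥ ·) hvw
    apply hinj
    rw [mulVec_zero, mulVec_mulVec, ← hD, hcol]
  simpa [hX] using congr_fun hXcol a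

/-- If congruence by a nonsingular `P` diagonalizes both `diag(B, 0)`, for each `B` in a family with
a nonsingular member `B i₀`, and `diag(C, G)`, then the blocks `B` and `C` are simultaneously
diagonalizable via congruence. -/
theorem exists_congr_isDiag_of_fromBlocks {ι : Type*} {P : Matrix (α ⊕ β) (α ⊕ β) K}
    (hP : IsUnit P) {B : ι → Matrix α α K} {C : Matrix α α K} {G : Matrix β β K}
    {i₀ : ι} (hB : IsUnit (B i₀))
    (hBP : ∀ i, (Pᵀ * fromBlocks (B i) 0 0 0 * P).IsDiag)
    (hCP : (Pᵀ * fromBlocks C 0 0 G * P).IsDiag) :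
    ∃ Q : Matrix α α K, IsUnit Q ∧ (∀ i, (Qᵀ * B i * Q).IsDiag) ∧ (Qᵀ * C * Q).IsDiag := by
  obtain ⟨f, hf, hQ, hzero⟩ := exists_columns_of_isDiag_congr hP hB (hBP i₀)
  set Q := P.submatrix Sum.inl f with hQdef
  set Y : Matrix β α K := P.submatrix Sum.inr f with hYdef
  refine ⟨Q, hQ, fun i => ?_, ?_⟩
  · have : Qᵀ * B i * Q = (Pᵀ * fromBlocks (B i) 0 0 0 * P).submatrix f f := by
      ext a b
      simp [hQdef, mul_apply, Fintype.sum_sum_type]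
    rw [this]
    exact (hBP i).submatrix hf
  have hGY : G * Y = 0 := by
    have hQt : IsUnit Qᵀ.det := by
      rw [det_transpose]; exact (isUnit_iff_isUnit_det Q).1 hQ
    have hPt : IsUnit Pᵀ.det := by
      rw [det_transpose]; exact (isUnit_iff_isUnit_det P).1 hP
    set U : Matrix α α K := -(Qᵀ⁻¹ * (Yᵀ * (G * Y))) with hU
    have hQU : Qᵀ * U + Yᵀ * (G * Y) = 0 := by
      rw [hU, Matrix.mul_neg, mul_nonsing_inv_cancel_left _ _ hQt, neg_add_cancel]
    have hPU : Pᵀ * fromRows U (G * Y) = 0 := by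
      ext j b
      rw [mul_apply, Fintype.sum_sum_type]
      simp only [fromRows_apply_inl, fromRows_apply_inr, transpose_apply, zero_apply]
      by_cases hj : j ∈ Set.range f
      · obtain ⟨a, rfl⟩ := hj
        have := congr_fun₂ hQU a b
        rw [add_apply, mul_apply, mul_apply (M := Yᵀ)] at this
        simpa [hQdef, hYdef] using this
      · have hne : j ≠ f b := fun h => hj ⟨b, h.symm⟩
        have := hCP hne
        rw [Matrix.mul_assoc, mul_apply, Fintype.sum_sum_type] at this
        simp only [transpose_apply, hzero j hj, zero_mul, Finset.sum_const_zero, zero_add]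
          at this ⊢
        rw [← this]
        simp [hYdef, mul_apply, Fintype.sum_sum_type]
    have hrows : fromRows U (G * Y) = 0 := by
      rw [← nonsing_inv_mul_cancel_left _ (fromRows U (G * Y)) hPt, hPU, Matrix.mul_zero]
    ext b a
    simpa using congr_fun₂ hrows (Sum.inr b) a
  have : Qᵀ * C * Q = (Pᵀ * fromBlocks C 0 0 G * P).submatrix f f := by
    have hsum : (Pᵀ * fromBlocks C 0 0 G * P).submatrix f f = Qᵀ * C * Q + Yᵀ * G * Y := by
      ext a b
      simp [hQdef, hYdef, mul_apply, Fintype.sum_sum_type]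
    rw [hsum, Matrix.mul_assoc Yᵀ, hGY, Matrix.mul_zero, add_zero]
  rw [this]
  exact hCP.submatrix hf

end Forward

/-- Congruence by a reindexed matrix is the reindexed congruence. -/
theorem transpose_submatrix_mul_mul_submatrix [Fintype α] [Fintype γ] (e : α ≃ γ)
    (P : Matrix γ γ K) (M : Matrix α α K) :
    (P.submatrix e e)ᵀ * M * P.submatrix e e = (Pᵀ * reindex e e M * P).submatrix e e := by
  have hM : M = (reindex e e M).submatrix e e := by simp
  conv_lhs => rw [hM]
  rw [transpose_submatrix, submatrix_mul_equiv, submatrix_mul_equiv]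

/-- Reindexing does not affect whether a congruence is diagonal. -/
theorem isDiag_congr_reindex_iff [Fintype α] [Fintype γ] (e : α ≃ γ)
    (P : Matrix γ γ K) (M : Matrix α α K) :
    (Pᵀ * reindex e e M * P).IsDiag ↔ ((P.submatrix e e)ᵀ * M * P.submatrix e e).IsDiag := by
  rw [transpose_submatrix_mul_mul_submatrix]
  refine ⟨fun h => h.submatrix e.injective, fun h => ?_⟩
  simpa using h.submatrix e.symm.injective

end Matrix

/-- Let `p ≥ 1`, `r ≥ 1`, `0 ≤ s ≤ r`, `n = p + r`.  For `i = 1, …, m-1` let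
`C̄ⁱ = diag(Cⁱ₁, 0_s, 0_{r-s})` with each `Cⁱ₁` real diagonal `p × p` and `C^{m-1}₁`
nonsingular, and `C̄^m = diag(C^m₁, C^m₆, 0_{r-s})` with `C^m₁` real symmetric `p × p` and
`C^m₆` nonsingular real diagonal `s × s`.  Then `C̄¹, …, C̄^m` are simultaneously
diagonalizable via congruence iff the north-west blocks `C¹₁, …, C^m₁` are simultaneously
diagonalizable via congruence. -/
theorem stmt_11 {n m p r s : ℕ} (hm : 2 ≤ m)
    (hp : 1 ≤ p) (hr : 1 ≤ r) (hs : s ≤ r) (hn : p + r = n)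
    (B : ℕ → Matrix (Fin p) (Fin p) ℝ)
    (hBdiag : ∀ i, 1 ≤ i → i ≤ m - 1 → (B i).IsDiag)
    (hBlast : IsUnit (B (m - 1)))
    (Cm1 : Matrix (Fin p) (Fin p) ℝ) (hCm1 : Cm1.IsSymm)
    (d6 : Fin s → ℝ) (hd6 : ∀ j, d6 j ≠ 0)
    (e : (Fin p ⊕ (Fin s ⊕ Fin (r - s))) ≃ Fin n)
    (he : e = tripleEquiv p s (r - s) n (by omega)) :
    (∃ P : Matrix (Fin n) (Fin n) ℝ, IsUnit P ∧
        (∀ i, 1 ≤ i → i ≤ m - 1 →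
          (Pᵀ * Matrix.reindex e e (Matrix.fromBlocks (B i) 0 0 0) * P).IsDiag) ∧
        (Pᵀ * Matrix.reindex e e
          (Matrix.fromBlocks Cm1 0 0
            (Matrix.fromBlocks (Matrix.diagonal d6) 0 0 0)) * P).IsDiag) ↔
      (∃ Q : Matrix (Fin p) (Fin p) ℝ, IsUnit Q ∧
        (∀ i, 1 ≤ i → i ≤ m - 1 → (Qᵀ * B i * Q).IsDiag) ∧
        (Qᵀ * Cm1 * Q).IsDiag) := by
  constructor
  · rintro ⟨P, hP, hBP, hCP⟩
    let i₀ : {i // 1 ≤ i ∧ i ≤ m - 1} := ⟨m - 1, by omega, le_rfl⟩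
    obtain ⟨Q, hQ, hBQ, hCQ⟩ := exists_congr_isDiag_of_fromBlocks
      (P := P.submatrix e e) ((isUnit_submatrix_equiv e e).2 hP)
      (B := fun i : {i // 1 ≤ i ∧ i ≤ m - 1} => B i) (i₀ := i₀) hBlast
      (fun i => (isDiag_congr_reindex_iff e P _).1 (hBP i i.2.1 i.2.2))
      ((isDiag_congr_reindex_iff e P _).1 hCP)
    exact ⟨Q, hQ, fun i h₁ h₂ => hBQ ⟨i, h₁, h₂⟩, hCQ⟩
  · rintro ⟨Q, hQ, hBQ, hCQ⟩
    let T : Matrix (Fin p ⊕ (Fin s ⊕ Fin (r - s))) (Fin p ⊕ (Fin s ⊕ Fin (r - s))) ℝ :=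
      fromBlocks Q 0 0 1
    have hcongr : ∀ (M : Matrix (Fin p) (Fin p) ℝ) (G), (Qᵀ * M * Q).IsDiag → G.IsDiag →
        ((reindex e e T)ᵀ * reindex e e (fromBlocks M 0 0 G) * reindex e e T).IsDiag := by
      intro M G hM hG
      rw [isDiag_congr_reindex_iff]
      simpa [T, fromBlocks_transpose, fromBlocks_multiply] using hM.fromBlocks hG
    refine ⟨reindex e e T, ?_, fun i h₁ h₂ => hcongr _ _ (hBQ i h₁ h₂) isDiag_zero,
      hcongr _ _ hCQ ((isDiag_diagonal d6).fromBlocks isDiag_zero)⟩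
    rw [isUnit_iff_isUnit_det] at hQ ⊢
    simpa [T] using hQ
end
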